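/- Let φ be a monotonic nonessential enhancement of range R₀ of site percolation on the square lattice ℤ², set R = 2R₀, and let ω be a configuration in which a site x is closed. Suppose there exist two closed *-paths γ*₁ and γ*₂ in ω, both starting at x, each containing a site outside the ball B_x(R) of radius R centred at x, and which, apart from the common starting site x, are disjoint and contain no pair of *-adjacent sites. Then x remains closed in the fully enhanced configuration ω̃, i.e., x ∉ ω̃. -/

import Mathlib

open MeasureTheory Filter Set Topology
open scoped ENNReal

namespace PercEnh

/-- Sites of the lattice (vertex set `ℤ²`). -/
abbrev Site : Type := ℤ × ℤ

/-- A configuration: the set of open sites. -/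
abbrev Config : Type := Set Site

/-- Square-lattice (`ℤ²`-) adjacency: `‖x − y‖₁ = 1`. -/
def adjZ2 (x y : Site) : Prop := |x.1 - y.1| + |x.2 - y.2| = 1

/-- Matching (star) adjacency: `x ≠ y` and `‖x − y‖_∞ = 1`. -/
def adjStar (x y : Site) : Prop := x ≠ y ∧ max |x.1 - y.1| |x.2 - y.2| = 1

/-- Euclidean norm of a site. -/
noncomputable def siteNorm (x : Site) : ℝ := Real.sqrt ((x.1 : ℝ) ^ 2 + (x.2 : ℝ) ^ 2)

/-- Sites in the closed Euclidean ball of radius `r` centred at the origin. -/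
def siteBall (r : ℝ) : Set Site := {x | siteNorm x ≤ r}

/-- The shifted configuration `τ_x ω = {y − x : y ∈ ω}`. -/
def shiftConfig (x : Site) (ω : Config) : Config := {y | y + x ∈ ω}

/-- An enhancement function of (finite) range `R₀`: takes values in subsets of
`𝔹₀ = ℤ² ∩ B(R₀)` and depends only on the restriction of the configuration to `𝔹₀`. -/
def IsEnhancement (R₀ : ℝ) (φ : Config → Config) : Prop :=
  0 ≤ R₀ ∧ (∀ ω, φ ω ⊆ siteBall R₀) ∧
    ∀ ω ω' : Config, ω ∩ siteBall R₀ = ω' ∩ siteBall R₀ → φ ω = φ ω'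

/-- A monotonic enhancement function. -/
def Monotonic (φ : Config → Config) : Prop := ∀ ω ω' : Config, ω ⊆ ω' → φ ω ⊆ φ ω'

/-- The translate `φ_x(ω) = x + φ₀(τ_x ω)`. -/
def enhAt (φ : Config → Config) (x : Site) (ω : Config) : Config :=
  (fun z => z + x) '' φ (shiftConfig x ω)

/-- The enhanced configuration `ω̂(ω, α) = ω ∪ ⋃_{x : α(x)=1} φ_x(ω)`. -/
def enhanced (φ : Config → Config) (ω : Config) (α : Site → Bool) : Config :=
  ω ∪ {y | ∃ x, α x = true ∧ y ∈ enhAt φ x ω}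

/-- The fully (deterministically, with `s = 1`) enhanced configuration `ω̃`. -/
def fullyEnhanced (φ : Config → Config) (ω : Config) : Config :=
  ω ∪ {y | ∃ x, y ∈ enhAt φ x ω}

/-- `ω` contains a doubly-infinite self-repelling path (w.r.t. adjacency `adj`):
a two-sided sequence of distinct sites of `ω` in which exactly the consecutive
pairs are adjacent. -/
def HasDISRPath (adj : Site → Site → Prop) (ω : Config) : Prop :=
  ∃ γ : ℤ → Site, Function.Injective γ ∧ (∀ i, γ i ∈ ω) ∧
    ∀ i j : ℤ, adj (γ i) (γ j) ↔ (j = i + 1 ∨ i = j + 1)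

/-- The enhancement is essential: some configuration without a doubly-infinite
self-repelling path acquires one upon enhancement at the origin. -/
def Essential (adj : Site → Site → Prop) (φ : Config → Config) : Prop :=
  ∃ ω : Config, ¬ HasDISRPath adj ω ∧ HasDISRPath adj (ω ∪ φ ω)

/-- A (finite, nonempty) path w.r.t. adjacency `adj`: distinct sites,
consecutive ones adjacent. -/
def IsPathOn (adj : Site → Site → Prop) (l : List Site) : Prop :=
  l ≠ [] ∧ l.Nodup ∧ l.Chain' adj

/-- `x` and `y` are joined by a path of sites of `ω`. -/
def ConnectedIn (adj : Site → Site → Prop) (ω : Config) (x y : Site) : Prop :=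
  ∃ l : List Site, IsPathOn adj l ∧ (∀ z ∈ l, z ∈ ω) ∧
    l.head? = some x ∧ l.getLast? = some y

/-- `x` belongs to an infinite open cluster of `ω`. -/
def InInfiniteCluster (adj : Site → Site → Prop) (ω : Config) (x : Site) : Prop :=
  {y | ConnectedIn adj ω x y}.Infinite

/-- `ω` contains an infinite open cluster. -/
def HasInfiniteCluster (adj : Site → Site → Prop) (ω : Config) : Prop :=
  ∃ x, InInfiniteCluster adj ω x

/-- The configuration corresponding to `η : Site → Bool`. -/
def toConfig (η : Site → Bool) : Config := {x | η x = true}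

/-- A cylinder event. -/
def cylinder (F : Finset Site) (b : Site → Bool) : Set (Site → Bool) :=
  {η | ∀ x ∈ F, η x = b x}

/-- `μ` is the Bernoulli product measure with density `p` of open sites. -/
def IsBernoulli (p : ℝ) (μ : Measure (Site → Bool)) : Prop :=
  IsProbabilityMeasure μ ∧
    ∀ (F : Finset Site) (b : Site → Bool),
      μ (cylinder F b) = ∏ x ∈ F, ENNReal.ofReal (if b x then p else 1 - p)

/-- The percolation probability `θ`: the probability that the origin lies in an
infinite open cluster. -/
noncomputable def theta (adj : Site → Site → Prop) (μ : Measure (Site → Bool)) : ℝ :=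
  (μ {η | InInfiniteCluster adj (toConfig η) 0}).toReal

/-- The percolation probability of the enhanced process (`μ` the law of the
configuration, `ν` the law of the activation variables). -/
noncomputable def thetaEnh (adj : Site → Site → Prop) (φ : Config → Config)
    (μ ν : Measure (Site → Bool)) : ℝ :=
  ((μ.prod ν) {ηα | InInfiniteCluster adj (enhanced φ (toConfig ηα.1) ηα.2) 0}).toReal

/-- The critical point `p_c = sup {p ∈ [0,1] : θ(p) = 0}` for the family `P`. -/
noncomputable def pcOf (adj : Site → Site → Prop) (P : ℝ → Measure (Site → Bool)) : ℝ :=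
  sSup {p | p ∈ Icc (0:ℝ) 1 ∧ theta adj (P p) = 0}

/-- The connectivity function `τ_p(x)`. -/
noncomputable def tau (adj : Site → Site → Prop) (μ : Measure (Site → Bool)) (x : Site) : ℝ :=
  (μ {η | ConnectedIn adj (toConfig η) 0 x}).toReal

/-- The connectivity function `τ_{p,s}(x)` of the enhanced process. -/
noncomputable def tauEnh (adj : Site → Site → Prop) (φ : Config → Config)
    (μ ν : Measure (Site → Bool)) (x : Site) : ℝ :=
  ((μ.prod ν) {ηα | ConnectedIn adj (enhanced φ (toConfig ηα.1) ηα.2) 0 x}).toReal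

/-- The mean cluster size `χ(p) = E_p‖C‖ = ∑_x τ_p(x)`. -/
noncomputable def chi (adj : Site → Site → Prop) (μ : Measure (Site → Bool)) : ℝ≥0∞ :=
  ∑' x : Site, μ {η | ConnectedIn adj (toConfig η) 0 x}

/-- The mean cluster size of the enhanced process. -/
noncomputable def chiEnh (adj : Site → Site → Prop) (φ : Config → Config)
    (μ ν : Measure (Site → Bool)) : ℝ≥0∞ :=
  ∑' x : Site, (μ.prod ν) {ηα | ConnectedIn adj (enhanced φ (toConfig ηα.1) ηα.2) 0 x}


/-- A closed `*`-path in `ω`: a finite sequence of distinct sites, consecutive ones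
`*`-adjacent, all of whose sites are closed. -/
def ClosedStarPath (ω : Config) (l : List Site) : Prop :=
  l ≠ [] ∧ l.Nodup ∧ l.Chain' adjStar ∧ ∀ z ∈ l, z ∉ ω

/-- `y` can be reached from `x` by `r`-steps into `S`. -/
def Linked {V : Type*} (r : V → V → Prop) (S : Set V) (x y : V) : Prop :=
  Relation.ReflTransGen (fun u v => r u v ∧ v ∈ S) x y

/-- `g 0, …, g n` is an induced `r`-path in `S` from `x` to `y`. -/
structure IsInducedPath {V : Type*} (r : V → V → Prop) (S : Set V) (x y : V) (n : ℕ)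
    (g : ℕ → V) : Prop where
  head : g 0 = x
  last : g n = y
  mem : ∀ i ≤ n, g i ∈ S
  step : ∀ i < n, r (g i) (g (i + 1))
  ne : ∀ i j, i < j → j ≤ n → g i ≠ g j
  induced : ∀ i j, i < j → j ≤ n → r (g i) (g j) → j = i + 1

theorem Linked.exists_isInducedPath {V : Type*} {r : V → V → Prop} {S : Set V} {x y : V}
    (h : Linked r S x y) (hx : x ∈ S) : ∃ n g, IsInducedPath r S x y n g := by
  classical
  have hex : ∃ n, ∃ g : ℕ → V, g 0 = x ∧ g n = y ∧ (∀ i ≤ n, g i ∈ S) ∧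
      ∀ i < n, r (g i) (g (i + 1)) := by
    induction h with
    | refl => exact ⟨0, fun _ => x, rfl, rfl, fun _ _ => hx, fun i hi => by omega⟩
    | @tail b c _ hbc ih =>
      obtain ⟨n, g, h0, hn, hm, hs⟩ := ih
      refine ⟨n + 1, fun i => if i ≤ n then g i else c, by simp [h0], by simp, ?_, ?_⟩
      · intro i _
        by_cases hi : i ≤ n
        · simpa [hi] using hm i hi
        · simpa [hi] using hbc.2
      · intro i hi
        by_cases hin : i + 1 ≤ n
        · simpa [hin, show i ≤ n by omega] using hs i (by omega)
        · obtain rfl : i = n := by omega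
          simpa [hn] using hbc.1
  obtain ⟨g, h0, hn, hm, hs⟩ := Nat.find_spec hex
  have hmin : ∀ k < Nat.find hex, ¬ _ := fun k hk => Nat.find_min hex hk
  generalize Nat.find hex = n at *
  refine ⟨n, g, h0, hn, hm, hs, ?_, ?_⟩
  · intro i j hij hj he
    refine hmin (n - (j - i)) (by omega)
      ⟨fun k => if k ≤ i then g k else g (k + (j - i)), by simp [h0], ?_, ?_, ?_⟩
    · by_cases hk : n - (j - i) ≤ i
      · have : n = j := by omega
        subst this
        simp [show n - (n - i) = i by omega, he, hn]
      · simp [hk, show n - (j - i) + (j - i) = n by omega, hn]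
    · intro k hk
      dsimp only
      split_ifs
      · exact hm _ (by omega)
      · exact hm _ (by omega)
    · intro k hk
      dsimp only
      by_cases h1 : k + 1 ≤ i
      · simpa [h1, show k ≤ i by omega] using hs k (by omega)
      · by_cases h2 : k ≤ i
        · obtain rfl : k = i := by omega
          simp only [le_refl, if_true, h1, if_false, he]
          have := hs j (by omega)
          rwa [show k + 1 + (j - k) = j + 1 by omega]
        · simp only [h1, h2, if_false]
          have := hs (k + (j - i)) (by omega)
          rwa [show k + 1 + (j - i) = k + (j - i) + 1 by omega]
  · intro i j hij hj he
    by_contra hne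
    refine hmin (n - (j - i - 1)) (by omega)
      ⟨fun k => if k ≤ i then g k else g (k + (j - i - 1)), by simp [h0], ?_, ?_, ?_⟩
    · simp [show ¬ n - (j - i - 1) ≤ i by omega,
        show n - (j - i - 1) + (j - i - 1) = n by omega, hn]
    · intro k hk
      dsimp only
      split_ifs
      · exact hm _ (by omega)
      · exact hm _ (by omega)
    · intro k hk
      dsimp only
      by_cases h1 : k + 1 ≤ i
      · simpa [h1, show k ≤ i by omega] using hs k (by omega)
      · by_cases h2 : k ≤ i
        · obtain rfl : k = i := by omega
          simp only [le_refl, if_true, h1, if_false]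
          rwa [show k + 1 + (j - k - 1) = j by omega]
        · simp only [h1, h2, if_false]
          have := hs (k + (j - i - 1)) (by omega)
          rwa [show k + 1 + (j - i - 1) = k + (j - i - 1) + 1 by omega]

theorem Linked.mono {V : Type*} {r : V → V → Prop} {S T : Set V} {x y : V}
    (h : Linked r S x y) (hST : S ⊆ T) : Linked r T x y :=
  Relation.ReflTransGen.mono (fun _ _ h => ⟨h.1, hST h.2⟩) _ _ h

theorem Linked.symm {V : Type*} {r : V → V → Prop} {S : Set V} {x y : V}
    (hr : ∀ u v, r u v → r v u) (h : Linked r S x y) (hx : x ∈ S) : Linked r S y x := by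
  have key : y ∈ S ∧ Linked r S y x := by
    induction h with
    | refl => exact ⟨hx, .refl⟩
    | tail _ hbc ih => exact ⟨hbc.2, .head ⟨hr _ _ hbc.1, ih.1⟩ ih.2⟩
  exact key.2

theorem adjZ2_symm {u v : Site} (h : adjZ2 u v) : adjZ2 v u := by
  unfold adjZ2 at *
  rwa [abs_sub_comm v.1, abs_sub_comm v.2]

theorem adjStar_symm {u v : Site} (h : adjStar u v) : adjStar v u := by
  unfold adjStar at *
  rw [abs_sub_comm v.1, abs_sub_comm v.2]
  exact ⟨h.1.symm, h.2⟩

theorem adjStar_iff {u v : Site} : adjStar u v ↔ (u.1 ≠ v.1 ∨ u.2 ≠ v.2) ∧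
    u.1 - v.1 ≤ 1 ∧ v.1 - u.1 ≤ 1 ∧ u.2 - v.2 ≤ 1 ∧ v.2 - u.2 ≤ 1 := by
  unfold adjStar
  rw [Ne, Prod.ext_iff]
  rcases abs_cases (u.1 - v.1) with h | h <;> rcases abs_cases (u.2 - v.2) with h' | h' <;> omega

theorem adjZ2_iff {u v : Site} : adjZ2 u v ↔
    (u.1 = v.1 ∧ (u.2 = v.2 + 1 ∨ v.2 = u.2 + 1)) ∨
    (u.2 = v.2 ∧ (u.1 = v.1 + 1 ∨ v.1 = u.1 + 1)) := by
  unfold adjZ2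
  rcases abs_cases (u.1 - v.1) with h | h <;> rcases abs_cases (u.2 - v.2) with h' | h' <;> omega

/-! ### Crossing parity -/

/-- Indicator of the step `u — v` joining the column of `y` to the next one, with its left endpoint
above `y`. -/
def crossing (u v y : Site) : ZMod 2 :=
  if (u.1 = y.1 ∧ v.1 = y.1 + 1 ∧ y.2 < u.2) ∨ (v.1 = y.1 ∧ u.1 = y.1 + 1 ∧ y.2 < v.2)
  then 1 else 0

/-- Parity of the number of steps of `g 0, …, g n` passing above the right of `y`. -/
def parity (n : ℕ) (g : ℕ → Site) (y : Site) : ZMod 2 :=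
  ∑ i ∈ Finset.range n, crossing (g i) (g (i + 1)) y

/-- Indicator of being strictly above `y` in the same column. -/
def above (y u : Site) : ZMod 2 := if u.1 = y.1 ∧ y.2 < u.2 then 1 else 0

theorem crossing_left {u v : Site} (h : adjStar u v) {a c : ℤ} (hu : u ≠ (a, c))
    (hv : v ≠ (a, c)) (hu' : u ≠ (a - 1, c)) (hv' : v ≠ (a - 1, c)) :
    crossing u v (a, c) = crossing u v (a - 1, c) + above (a, c) u + above (a, c) v := by
  rw [adjStar_iff] at h
  obtain ⟨u1, u2⟩ := u
  obtain ⟨v1, v2⟩ := v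
  simp only [Ne, Prod.mk.injEq] at *
  unfold crossing above
  dsimp only
  have h2 : (1 : ZMod 2) + 1 = 0 := rfl
  split_ifs <;> first | omega | simp [h2]

theorem parity_left {n : ℕ} {g : ℕ → Site} (hg : ∀ i < n, adjStar (g i) (g (i + 1))) {a c : ℤ}
    (h : ∀ i ≤ n, g i ≠ (a, c)) (h' : ∀ i ≤ n, g i ≠ (a - 1, c)) :
    parity n g (a, c) = parity n g (a - 1, c) + above (a, c) (g 0) + above (a, c) (g n) := by
  induction n with
  | zero => simp [parity, CharTwo.add_self_eq_zero]
  | succ n ih =>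
    have ih' := ih (fun i hi => hg i (by omega)) (fun i hi => h i (by omega))
      (fun i hi => h' i (by omega))
    unfold parity at *
    rw [Finset.sum_range_succ, Finset.sum_range_succ, ih',
      crossing_left (hg n (by omega)) (h _ (by omega)) (h _ (by omega)) (h' _ (by omega))
        (h' _ (by omega))]
    have := CharTwo.add_self_eq_zero (above (a, c) (g n))
    linear_combination this

theorem parity_up {n : ℕ} {g : ℕ → Site} {a c : ℤ} (h : ∀ i ≤ n, g i ≠ (a, c + 1)) :
    parity n g (a, c) = parity n g (a, c + 1) := by
  refine Finset.sum_congr rfl fun i hi => ?_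
  rw [Finset.mem_range] at hi
  have h1 := h i (by omega)
  have h2 := h (i + 1) (by omega)
  rw [Ne, Prod.ext_iff] at h1 h2
  unfold crossing
  dsimp only at *
  congr 1
  apply propext
  omega

/-! ### The eight sites around a site -/

/-- The `*`-neighbours of `c` in counterclockwise order, indexed modulo `8`. -/
def ringSite (c : Site) (i : ℤ) : Site :=
  (c.1 + if i % 8 = 7 ∨ i % 8 ≤ 1 then 1 else if 3 ≤ i % 8 ∧ i % 8 ≤ 5 then -1 else 0,
   c.2 + if 1 ≤ i % 8 ∧ i % 8 ≤ 3 then 1 else if 5 ≤ i % 8 then -1 else 0)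

theorem adjStar_ringSite (c : Site) (i : ℤ) : adjStar c (ringSite c i) := by
  rw [adjStar_iff]
  unfold ringSite
  dsimp only
  split_ifs <;> omega

theorem adjZ2_ringSite (c : Site) (i : ℤ) : adjZ2 (ringSite c i) (ringSite c (i + 1)) := by
  rw [adjZ2_iff]
  unfold ringSite
  dsimp only
  split_ifs <;> omega

theorem adjStar_of_adjZ2 {u v : Site} (h : adjZ2 u v) : adjStar u v := by
  rw [adjZ2_iff] at h
  rw [adjStar_iff]
  omega

theorem ringSite_injective {c : Site} {i j : ℤ} (h : ringSite c i = ringSite c j) :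
    i % 8 = j % 8 := by
  unfold ringSite at h
  simp only [Prod.mk.injEq, add_right_inj] at h
  obtain ⟨h1, h2⟩ := h
  split_ifs at h1 <;> split_ifs at h2 <;> omega

theorem exists_ringSite {c y : Site} (h : adjStar c y) (j : ℤ) :
    ∃ t, 0 ≤ t ∧ t < 8 ∧ y = ringSite c (j + t) := by
  have key : ∃ i, 0 ≤ i ∧ i < 8 ∧ y = ringSite c i := by
    rw [adjStar_iff] at h
    obtain ⟨h0, h1, h2, h3, h4⟩ := h
    have hx : y.1 = c.1 + 1 ∨ y.1 = c.1 ∨ y.1 = c.1 - 1 := by omega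
    have hy : y.2 = c.2 + 1 ∨ y.2 = c.2 ∨ y.2 = c.2 - 1 := by omega
    simp only [ringSite, Prod.ext_iff]
    rcases hx with hx | hx | hx <;> rcases hy with hy | hy | hy
    · exact ⟨1, by omega⟩
    · exact ⟨0, by omega⟩
    · exact ⟨7, by omega⟩
    · exact ⟨2, by omega⟩
    · omega
    · exact ⟨6, by omega⟩
    · exact ⟨3, by omega⟩
    · exact ⟨4, by omega⟩
    · exact ⟨5, by omega⟩
  obtain ⟨i, -, -, rfl⟩ := key
  refine ⟨(i - j) % 8, by omega, by omega, ?_⟩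
  unfold ringSite
  rw [show (j + (i - j) % 8) % 8 = i % 8 by omega]

/-- A property of the sites around `c` other than two non-`*`-adjacent ones `u`, `w` holds everywhere
if it holds next to `u` and spreads along `ℤ²`-adjacency. -/
theorem ring_induction {c u w : Site} {T : Site → Prop} (hu : adjStar c u) (hw : adjStar c w)
    (huw : u ≠ w) (hn : ¬ adjStar u w) (h0 : ∀ y, adjStar c y → adjStar u y → T y)
    (hs : ∀ y y', adjStar c y' → y' ≠ u → y' ≠ w → adjZ2 y y' → T y → T y') :
    ∀ y, adjStar c y → y ≠ u → y ≠ w → T y := by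
  intro y hy hyu hyw
  obtain ⟨j, -, -, hj⟩ := exists_ringSite hu 0
  rw [zero_add] at hj
  subst hj
  obtain ⟨τ, hτ0, hτ8, rfl⟩ := exists_ringSite hw j
  obtain ⟨t, ht0, ht8, rfl⟩ := exists_ringSite hy j
  have hτne : τ ≠ 0 := by rintro rfl; simp at huw
  have hdown : ringSite c (j + 7 + 1) = ringSite c j := by
    unfold ringSite
    rw [show (j + 7 + 1) % 8 = j % 8 by omega]
  have hτ1 : τ ≠ 1 := by
    rintro rfl
    exact hn (adjStar_of_adjZ2 (adjZ2_ringSite c j))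
  have hτ7 : τ ≠ 7 := by
    rintro rfl
    have := adjZ2_ringSite c (j + 7)
    rw [hdown] at this
    exact hn (adjStar_symm (adjStar_of_adjZ2 this))
  have htne : t ≠ 0 := by rintro rfl; simp at hyu
  have htτ : t ≠ τ := by rintro rfl; exact hyw rfl
  have hne : ∀ s, 0 < s → s < 8 → s ≠ τ →
      ringSite c (j + s) ≠ ringSite c j ∧ ringSite c (j + s) ≠ ringSite c (j + τ) := by
    intro s h1 h2 h3
    refine ⟨fun h => ?_, fun h => ?_⟩ <;> have := ringSite_injective h <;> omega
  have up : ∀ n : ℕ, (n : ℤ) + 1 < τ → T (ringSite c (j + (n + 1))) := by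
    intro n
    induction n with
    | zero =>
      intro _
      simpa using h0 _ (adjStar_ringSite c (j + 1)) (adjStar_of_adjZ2 (adjZ2_ringSite c j))
    | succ n ih =>
      intro h
      push_cast at h ⊢
      have := hne (n + 1 + 1) (by omega) (by omega) (by omega)
      refine hs _ _ (adjStar_ringSite c _) this.1 this.2 ?_ (ih (by omega))
      simpa [add_assoc] using adjZ2_ringSite c (j + (n + 1))
  have down : ∀ n : ℕ, τ < 7 - n → T (ringSite c (j + (7 - n))) := by
    intro n
    induction n with
    | zero =>
      intro _
      have := adjZ2_ringSite c (j + 7)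
      rw [hdown] at this
      simpa using h0 _ (adjStar_ringSite c (j + 7)) (adjStar_symm (adjStar_of_adjZ2 this))
    | succ n ih =>
      intro h
      push_cast at h ⊢
      have := hne (7 - (n + 1)) (by omega) (by omega) (by omega)
      refine hs _ _ (adjStar_ringSite c _) this.1 this.2 ?_ (ih (by omega))
      have h2 := adjZ2_ringSite c (j + (7 - (n + 1)))
      rw [show j + (7 - ((n : ℤ) + 1)) + 1 = j + (7 - n) by ring] at h2
      exact adjZ2_symm h2
  by_cases h : t < τ
  · have := up (t - 1).toNat (by omega)
    rwa [show (((t - 1).toNat : ℤ) + 1) = t by omega] at this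
  · have := down (7 - t).toNat (by omega)
    rwa [show (7 - ((7 - t).toNat : ℤ)) = t by omega] at this

/-- Around `c`, after removing two non-`*`-adjacent sites, every site is a `ℤ²`-neighbour of `c` or of
a remaining `ℤ²`-neighbour of `c`. -/
theorem ring_center {c u w y : Site} (hn : ¬ adjStar u w) (hy : adjStar c y) :
    adjZ2 c y ∨ ∃ y', y' ≠ u ∧ y' ≠ w ∧ adjZ2 c y' ∧ adjZ2 y' y := by
  by_cases hcy : adjZ2 c y
  · exact .inl hcy
  refine .inr ?_
  rw [adjZ2_iff] at hcy
  rw [adjStar_iff] at hy hn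
  by_cases h1 : (y.1, c.2) ≠ u ∧ (y.1, c.2) ≠ w
  · refine ⟨_, h1.1, h1.2, ?_, ?_⟩ <;> rw [adjZ2_iff] <;> dsimp only <;> omega
  · refine ⟨(c.1, y.2), ?_⟩
    rw [adjZ2_iff, adjZ2_iff]
    rw [Ne, Ne, Prod.ext_iff, Prod.ext_iff] at *
    dsimp only at *
    omega

/-! ### Doubly-infinite paths -/

theorem eq_add_of_injective_of_bddBelow {h : ℕ → ℤ} {B : ℤ} (hinj : Function.Injective h)
    (hstep : ∀ n, h (n + 1) = h n + 1 ∨ h n = h (n + 1) + 1) (hB : ∀ n, B ≤ h n) (n : ℕ) :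
    h n = h 0 + n := by
  have hup : ∀ k, h (k + 1) = h k + 1 := by
    intro k
    by_contra hk
    have hdown : ∀ t : ℕ, h (k + t) = h k - t ∧ h (k + t + 1) = h k - t - 1 := by
      intro t
      induction t with
      | zero => have := hstep k; simp; omega
      | succ t ih =>
        have h1 := hstep (k + t + 1)
        have h2 : h (k + t + 1 + 1) ≠ h (k + t) := fun he => by have := hinj he; omega
        rw [show k + (t + 1) = k + t + 1 by omega]
        push_cast
        omega
    have h1 := (hdown (h k - B + 1).toNat).1
    have h2 := hB (k + (h k - B + 1).toNat)
    have h3 := hB k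
    omega
  induction n with
  | zero => simp
  | succ n ih => rw [hup, ih]; push_cast; ring

/-- A finite box with one ray attached contains no doubly-infinite path. -/
theorem not_path_in_box_union_ray {M t : ℤ} {γ : ℤ → Site} (hinj : Function.Injective γ)
    (hadj : ∀ i, adjZ2 (γ i) (γ (i + 1))) (hray : ∀ i, M < (γ i).1 → (γ i).2 = t)
    (hbox : ∀ i, (γ i).1 ≤ M → γ i ∈ Icc ((-M, -M) : Site) (M, M)) : False := by
  have hfin : (γ ⁻¹' Icc ((-M, -M) : Site) (M, M)).Finite :=
    (Set.finite_Icc _ _).preimage hinj.injOn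
  obtain ⟨K, hK⟩ := hfin.bddAbove
  obtain ⟨L, hL⟩ := hfin.bddBelow
  have hright : ∀ i, K < i ∨ i < L → M < (γ i).1 := by
    intro i hi
    by_contra hc
    have h1 := hbox i (by omega)
    have h2 := hK h1
    have h3 := hL h1
    omega
  have hN : ∀ i j, (K < i ∨ i < L) → (K < j ∨ j < L) → (γ i).1 = (γ j).1 → i = j :=
    fun i j hi hj he => hinj (Prod.ext he ((hray i (hright i hi)).trans (hray j (hright j hj)).symm))
  have hst : ∀ i, (K < i ∨ i < L) → (K < i + 1 ∨ i + 1 < L) →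
      (γ (i + 1)).1 = (γ i).1 + 1 ∨ (γ i).1 = (γ (i + 1)).1 + 1 := by
    intro i hi hi'
    have h1 := hray i (hright i hi)
    have h2 := hray (i + 1) (hright _ hi')
    have h3 := adjZ2_iff.1 (hadj i)
    omega
  have hp := eq_add_of_injective_of_bddBelow (h := fun n : ℕ => (γ (K + 1 + n)).1) (B := M)
    (fun m n hmn => by
      have := hN (K + 1 + m) (K + 1 + n) (by omega) (by omega) hmn
      omega)
    (fun n => by
      have := hst (K + 1 + n) (by omega) (by omega)
      push_cast
      rw [← add_assoc]
      exact this)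
    (fun n => (hright _ (by omega)).le)
  have hm := eq_add_of_injective_of_bddBelow (h := fun n : ℕ => (γ (min L K - 1 - n)).1) (B := M)
    (fun m n hmn => by
      have := hN (min L K - 1 - m) (min L K - 1 - n) (by omega) (by omega) hmn
      omega)
    (fun n => by
      have := hst (min L K - 1 - (n + 1)) (by omega) (by omega)
      push_cast
      rw [show min L K - 1 - ((n : ℤ) + 1) + 1 = min L K - 1 - n by ring] at this
      exact this.symm)
    (fun n => (hright _ (by omega)).le)
  simp only [Nat.cast_zero, add_zero, sub_zero] at hp hm
  set α := (γ (K + 1)).1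
  set β := (γ (min L K - 1)).1
  have h1 := hp (β - α).toNat
  have h2 := hm (α - β).toNat
  have := hN (K + 1 + (β - α).toNat) (min L K - 1 - (α - β).toNat) (by omega) (by omega) (by omega)
  omega

/-- An induced path between the tips of two parallel rays extends along them. -/
theorem hasDISRPath_of_rays {M b : ℤ} {n : ℕ} {g : ℕ → Site} {A S : Config}
    (hg : IsInducedPath adjZ2 A (M, b + 1) (M, b - 1) n g) (hA : ∀ u ∈ A, u.1 ≤ M) (hAS : A ⊆ S)
    (hS : ∀ c, M < c → (c, b + 1) ∈ S ∧ (c, b - 1) ∈ S) : HasDISRPath adjZ2 S := by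
  set γ : ℤ → Site := fun i =>
    if i < 0 then (M - i, b + 1) else if i ≤ n then g i.toNat else (M + (i - n), b - 1) with hγ
  have key : ∀ i j, i < j → γ i ≠ γ j ∧ (adjZ2 (γ i) (γ j) ↔ j = i + 1) := by
    intro i j hij
    by_cases hi : i < 0
    · have ei : γ i = (M - i, b + 1) := by simp [hγ, hi]
      by_cases hj : j < 0
      · have ej : γ j = (M - j, b + 1) := by simp [hγ, hj]
        rw [ei, ej, adjZ2_iff, Ne, Prod.ext_iff]
        dsimp only
        omega
      by_cases hj' : j ≤ n
      · have ej : γ j = g j.toNat := by simp [hγ, hj, hj']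
        rw [ei, ej]
        have hm := hA _ (hg.mem j.toNat (by omega))
        refine ⟨fun h => by rw [← h] at hm; dsimp only at hm; omega, ?_⟩
        rw [adjZ2_iff]
        dsimp only
        constructor
        · intro h
          have h0 : g 0 = g j.toNat := by rw [hg.head, Prod.ext_iff]; dsimp only; omega
          by_contra hne
          exact hg.ne 0 j.toNat (by omega) (by omega) h0
        · rintro rfl
          have : i = -1 := by omega
          subst this
          simp [hg.head]
      · have ej : γ j = (M + (j - n), b - 1) := by simp [hγ, hj, hj']
        rw [ei, ej, adjZ2_iff, Ne, Prod.ext_iff]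
        dsimp only
        omega
    by_cases hi' : i ≤ n
    · have ei : γ i = g i.toNat := by simp [hγ, hi, hi']
      by_cases hj' : j ≤ n
      · have ej : γ j = g j.toNat := by simp [hγ, hj', show ¬ j < 0 by omega]
        rw [ei, ej]
        refine ⟨hg.ne _ _ (by omega) (by omega), fun h => ?_, ?_⟩
        · have := hg.induced _ _ (by omega) (by omega) h
          omega
        · rintro rfl
          rw [show (i + 1).toNat = i.toNat + 1 by omega]
          exact hg.step _ (by omega)
      · have ej : γ j = (M + (j - n), b - 1) := by simp [hγ, hj', show ¬ j < 0 by omega]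
        rw [ei, ej]
        have hm := hA _ (hg.mem i.toNat (by omega))
        refine ⟨fun h => by rw [h] at hm; dsimp only at hm; omega, ?_⟩
        rw [adjZ2_iff]
        dsimp only
        constructor
        · intro h
          have h0 : g i.toNat = g n := by rw [hg.last, Prod.ext_iff]; dsimp only; omega
          by_contra hne
          exact hg.ne i.toNat n (by omega) le_rfl h0
        · rintro rfl
          have : i = n := by omega
          subst this
          simp [hg.last]
    · have ei : γ i = (M + (i - n), b - 1) := by simp [hγ, hi, hi']
      have ej : γ j = (M + (j - n), b - 1) := by
        simp [hγ, show ¬ j < 0 by omega, show ¬ j ≤ n by omega]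
      rw [ei, ej, adjZ2_iff, Ne, Prod.ext_iff]
      dsimp only
      omega
  refine ⟨γ, fun i j he => ?_, fun i => ?_, fun i j => ?_⟩
  · rcases lt_trichotomy i j with h | h | h
    · exact absurd he (key i j h).1
    · exact h
    · exact absurd he.symm (key j i h).1
  · simp only [hγ]
    split_ifs
    · exact (hS _ (by omega)).1
    · exact hAS (hg.mem _ (by omega))
    · exact (hS _ (by omega)).2
  · rcases lt_trichotomy i j with h | rfl | h
    · rw [(key i j h).2]; omega
    · simp [adjZ2]
    · rw [show adjZ2 (γ i) (γ j) ↔ adjZ2 (γ j) (γ i) from ⟨adjZ2_symm, adjZ2_symm⟩, (key j i h).2]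
      omega

/-! ### The two sides of a path crossing a box -/

/-- The sites of `g 0, …, g n`. -/
def pathSites (n : ℕ) (g : ℕ → Site) : Set Site := {u | ∃ i ≤ n, g i = u}

/-- The side of the path formed by `g 0, …, g n` and `k 0, …, k m` on which `y` lies, within the box
of radius `M`, when the latter part ends at `e` outside the box. -/
def side (M : ℤ) (e : Site) (n : ℕ) (g : ℕ → Site) (m : ℕ) (k : ℕ → Site) (y : Site) : ZMod 2 :=
  parity n g y + parity m k y + if M < e.2 ∧ e.1 ≤ y.1 then 1 else 0

theorem side_eq_of_adj {M b : ℤ} {x e : Site} {n m : ℕ} {g k : ℕ → Site} {P Q : Set Site}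
    (hg : IsInducedPath adjStar P x (M + 1, b) n g) (hk : IsInducedPath adjStar Q x e m k)
    (he : e ∉ Icc ((-M, -M) : Site) (M, M)) {y y' : Site} (hy : y ∈ Icc ((-M, -M) : Site) (M, M))
    (hy' : y' ∈ Icc ((-M, -M) : Site) (M, M)) (hyg : y ∉ pathSites n g) (hyk : y ∉ pathSites m k)
    (hyg' : y' ∉ pathSites n g) (hyk' : y' ∉ pathSites m k) (h : adjZ2 y y') :
    side M e n g m k y = side M e n g m k y' := by
  have vert : ∀ a c : ℤ, (a, c + 1) ∉ pathSites n g → (a, c + 1) ∉ pathSites m k →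
      side M e n g m k (a, c) = side M e n g m k (a, c + 1) := by
    intro a c h1 h2
    unfold side
    rw [parity_up (fun i hi h => h1 ⟨i, hi, h⟩), parity_up (fun i hi h => h2 ⟨i, hi, h⟩)]
  have horiz : ∀ a c : ℤ, (a, c) ∈ Icc ((-M, -M) : Site) (M, M) → (a, c) ∉ pathSites n g →
      (a, c) ∉ pathSites m k → (a - 1, c) ∉ pathSites n g → (a - 1, c) ∉ pathSites m k →
      side M e n g m k (a, c) = side M e n g m k (a - 1, c) := by
    intro a c hac h1 h2 h3 h4
    have hp := parity_left hg.step (fun i hi h => h1 ⟨i, hi, h⟩) (fun i hi h => h3 ⟨i, hi, h⟩)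
    have hq := parity_left hk.step (fun i hi h => h2 ⟨i, hi, h⟩) (fun i hi h => h4 ⟨i, hi, h⟩)
    rw [hg.head, hg.last] at hp
    rw [hk.head, hk.last] at hq
    simp only [mem_Icc, Prod.le_def] at hac he
    have hend : above (a, c) (M + 1, b) = 0 := by
      unfold above
      rw [if_neg]
      dsimp only
      omega
    have hcorr : (if M < e.2 ∧ e.1 ≤ a then (1 : ZMod 2) else 0) =
        (if M < e.2 ∧ e.1 ≤ a - 1 then 1 else 0) + above (a, c) e := by
      unfold above
      dsimp only
      split_ifs <;> first | omega | simp
    unfold side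
    dsimp only
    rw [hp, hq, hcorr, hend]
    have h1 := CharTwo.add_self_eq_zero (above (a, c) x)
    have h2 := CharTwo.add_self_eq_zero (above (a, c) e)
    linear_combination h1 + h2
  obtain ⟨y1, y2⟩ := y
  obtain ⟨z1, z2⟩ := y'
  rw [adjZ2_iff] at h
  dsimp only at h
  rcases h with ⟨rfl, rfl | rfl⟩ | ⟨rfl, rfl | rfl⟩
  · exact (vert _ _ hyg hyk).symm
  · exact vert _ _ hyg' hyk'
  · have := horiz (z1 + 1) y2 hy hyg hyk
    rw [add_sub_cancel_right] at this
    exact this hyg' hyk'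
  · have := horiz (y1 + 1) y2 hy' hyg' hyk'
    rw [add_sub_cancel_right] at this
    exact (this hyg hyk).symm

/-- Hypotheses on two sets of sites meeting at `x`: `P` leads from `x` to the right side of the box of
radius `M`, ending in a straight piece in row `b`; `Q` leads from `x` to a site `e` outside the box;
away from `x` they are separated. -/
structure IsCrossing (M b : ℤ) (x e : Site) (P Q : Set Site) : Prop where
  b_mem : -(M - 1) ≤ b ∧ b ≤ M - 1
  x_mem : -(M - 1) ≤ x.1 ∧ x.1 ≤ M - 2 ∧ -(M - 1) ≤ x.2 ∧ x.2 ≤ M - 1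
  P_mem : ∀ u ∈ P, -(M - 1) ≤ u.1 ∧ u.1 ≤ M + 1 ∧ -(M - 1) ≤ u.2 ∧ u.2 ≤ M - 1 ∧
    (M - 1 ≤ u.1 → u.2 = b)
  e_not_mem : e ∉ Icc ((-M, -M) : Site) (M, M)
  x_mem_P : x ∈ P
  x_mem_Q : x ∈ Q
  linked_P : Linked adjStar P x (M + 1, b)
  linked_Q : Linked adjStar Q x e
  sep : ∀ u ∈ P, ∀ w ∈ Q, u ≠ x → w ≠ x → u ≠ w ∧ ¬ adjStar u w

section Crossing

variable {M b : ℤ} {x e : Site} {P Q : Set Site} {n m : ℕ} {g k : ℕ → Site}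

theorem IsCrossing.tip (h : IsCrossing M b x e P Q)
    (hg : IsInducedPath adjStar P x (M + 1, b) n g) :
    3 ≤ n ∧ g (n - 1) = (M, b) ∧ g (n - 2) = (M - 1, b) := by
  have hx := h.x_mem
  have hn : n ≠ 0 := by
    rintro rfl
    have := hg.head.symm.trans hg.last
    rw [Prod.ext_iff] at this
    dsimp only at this
    omega
  have h1 : g (n - 1) = (M, b) := by
    have a1 := hg.step (n - 1) (by omega)
    rw [show n - 1 + 1 = n by omega, hg.last, adjStar_iff] at a1
    have a2 := h.P_mem _ (hg.mem (n - 1) (by omega))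
    rw [Prod.ext_iff]
    dsimp only at *
    omega
  have hn1 : n ≠ 1 := by
    rintro rfl
    have := hg.head.symm.trans h1
    rw [Prod.ext_iff] at this
    dsimp only at this
    omega
  have h2 : g (n - 2) = (M - 1, b) := by
    have a1 := hg.step (n - 2) (by omega)
    rw [show n - 2 + 1 = n - 1 by omega, h1, adjStar_iff] at a1
    have a2 := h.P_mem _ (hg.mem (n - 2) (by omega))
    have a3 := hg.ne (n - 2) n (by omega) le_rfl
    rw [hg.last, Ne, Prod.ext_iff] at a3
    rw [Prod.ext_iff]
    dsimp only at *
    omega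
  have hn2 : n ≠ 2 := by
    rintro rfl
    have := hg.head.symm.trans h2
    rw [Prod.ext_iff] at this
    dsimp only at this
    omega
  exact ⟨by omega, h1, h2⟩

/-- The two sites beside the tip of the first part are not on the path. -/
theorem IsCrossing.beside (h : IsCrossing M b x e P Q)
    (hg : IsInducedPath adjStar P x (M + 1, b) n g) (hk : IsInducedPath adjStar Q x e m k)
    {c : ℤ} (hc : c = b + 1 ∨ c = b - 1) :
    (M, c) ∉ pathSites n g ∧ (M, c) ∉ pathSites m k := by
  obtain ⟨hn, h1, h2⟩ := h.tip hg
  have hx := h.x_mem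
  constructor
  · rintro ⟨i, hi, he⟩
    have := h.P_mem _ (hg.mem i hi)
    rw [he] at this
    dsimp only at this
    omega
  · rintro ⟨i, hi, he⟩
    have := h.sep _ (hg.mem (n - 1) (by omega)) _ (hk.mem i hi)
      (by rw [h1, Ne, Prod.ext_iff]; dsimp only; omega)
      (by rw [he, Ne, Prod.ext_iff]; dsimp only; omega)
    rw [h1, he, adjStar_iff] at this
    dsimp only at this
    omega

theorem IsCrossing.side_ne (h : IsCrossing M b x e P Q)
    (hg : IsInducedPath adjStar P x (M + 1, b) n g) (hk : IsInducedPath adjStar Q x e m k) :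
    side M e n g m k (M, b + 1) ≠ side M e n g m k (M, b - 1) := by
  obtain ⟨hn, h1, h2⟩ := h.tip hg
  have hx := h.x_mem
  have hq : parity m k (M, b - 1) = parity m k (M, b + 1) := by
    have hmid : (M, b) ∉ pathSites m k := by
      rintro ⟨i, hi, he⟩
      have := h.sep _ (hg.mem (n - 1) (by omega)) _ (hk.mem i hi)
        (by rw [h1, Ne, Prod.ext_iff]; dsimp only; omega)
        (by rw [he, Ne, Prod.ext_iff]; dsimp only; omega)
      exact this.1 (h1.trans he.symm)
    rw [← parity_up fun i hi he => (h.beside hg hk (.inl rfl)).2 ⟨i, hi, he⟩]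
    have := parity_up (n := m) (g := k) (a := M) (c := b - 1)
      (by rw [sub_add_cancel]; exact fun i hi he => hmid ⟨i, hi, he⟩)
    rwa [sub_add_cancel] at this
  have hcol : ∀ i ≤ n, (g i).1 = M + 1 → i = n := by
    intro i hi he
    by_contra hne
    refine hg.ne i n (by omega) le_rfl ?_
    have := h.P_mem _ (hg.mem i hi)
    rw [hg.last, Prod.ext_iff]
    dsimp only
    omega
  have hp1 : parity n g (M, b + 1) = 0 := by
    refine Finset.sum_eq_zero fun i hi => ?_
    rw [Finset.mem_range] at hi
    have a1 := h.P_mem _ (hg.mem i hi.le)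
    have a2 := h.P_mem _ (hg.mem (i + 1) hi)
    unfold crossing
    rw [if_neg]
    dsimp only
    omega
  have hp2 : parity n g (M, b - 1) = 1 := by
    unfold parity
    rw [Finset.sum_eq_single (n - 1)]
    · rw [show n - 1 + 1 = n by omega, h1, hg.last]
      simp [crossing]
    · intro i hi hne
      rw [Finset.mem_range] at hi
      have a1 := hcol i hi.le
      have a2 := hcol (i + 1) hi
      unfold crossing
      rw [if_neg]
      dsimp only
      omega
    · intro hc
      exact absurd (Finset.mem_range.2 (by omega)) hc
  unfold side
  rw [hp1, hp2, hq]
  simp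

theorem IsCrossing.ring_eq_or (h : IsCrossing M b x e P Q)
    (hg : IsInducedPath adjStar P x (M + 1, b) n g) (hk : IsInducedPath adjStar Q x e m k)
    {i : ℕ} (hi : i + 1 < n) {y : Site} (hy : adjStar (g (i + 1)) y)
    (hp : y ∈ pathSites n g ∨ y ∈ pathSites m k) : y = g i ∨ y = g (i + 2) := by
  have hgx : ∀ j, 0 < j → j ≤ n → g j ≠ x := fun j h0 hj he =>
    hg.ne 0 j h0 hj (hg.head.trans he.symm)
  have main : ∀ j ≤ n, y = g j → y = g i ∨ y = g (i + 2) := by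
    rintro j hj rfl
    rcases lt_trichotomy (i + 1) j with hlt | rfl | hlt
    · have := hg.induced _ _ hlt hj hy
      subst this
      exact .inr rfl
    · exact absurd rfl hy.1
    · have := hg.induced _ _ hlt (by omega) (adjStar_symm hy)
      obtain rfl : i = j := by omega
      exact .inl rfl
  rcases hp with ⟨j, hj, he⟩ | ⟨j, hj, he⟩
  · exact main j hj he.symm
  · by_cases hyx : y = x
    · exact main 0 (by omega) (hyx.trans hg.head.symm)
    · subst he
      exact absurd hy (h.sep _ (hg.mem (i + 1) (by omega)) _ (hk.mem j hj)
        (hgx _ (by omega) (by omega)) hyx).2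

theorem IsCrossing.inner (h : IsCrossing M b x e P Q)
    (hg : IsInducedPath adjStar P x (M + 1, b) n g) {i : ℕ} (hi : i + 2 ≤ n) {y : Site}
    (hy : adjStar (g i) y) : y ∈ Icc ((-M, -M) : Site) (M, M) := by
  obtain ⟨hn, h1, h2⟩ := h.tip hg
  have a1 := hg.ne i n (by omega) le_rfl
  have a2 := hg.ne i (n - 1) (by omega) (by omega)
  rw [hg.last, Ne, Prod.ext_iff] at a1
  rw [h1, Ne, Prod.ext_iff] at a2
  have a3 := h.P_mem _ (hg.mem i (by omega))
  rw [adjStar_iff] at hy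
  simp only [mem_Icc, Prod.le_def]
  dsimp only at *
  omega

/-- Every site next to the first part of the path is connected to `x` off the path. -/
theorem IsCrossing.linked_ring (h : IsCrossing M b x e P Q)
    (hg : IsInducedPath adjStar P x (M + 1, b) n g) (hk : IsInducedPath adjStar Q x e m k)
    {i : ℕ} (hi : i + 2 ≤ n) {y : Site} (hy : adjStar (g i) y) (hyg : y ∉ pathSites n g)
    (hyk : y ∉ pathSites m k) :
    Linked adjZ2 (insert x (Icc ((-M, -M) : Site) (M, M) \ (pathSites n g ∪ pathSites m k)))
      x y := by
  obtain ⟨hn, h1, h2⟩ := h.tip hg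
  have hx := h.x_mem
  induction i generalizing y with
  | zero =>
    have hm : m ≠ 0 := by
      rintro rfl
      have := hk.head.symm.trans hk.last
      refine h.e_not_mem ?_
      rw [← this]
      simp only [mem_Icc, Prod.le_def]
      omega
    have hsep := h.sep _ (hg.mem 1 (by omega)) _ (hk.mem 1 (by omega))
      (by rw [← hg.head]; exact (hg.ne 0 1 (by omega) (by omega)).symm)
      (by rw [← hk.head]; exact (hk.ne 0 1 (by omega) (by omega)).symm)
    have hon : ∀ y', adjStar x y' → y' ≠ g 1 → y' ≠ k 1 →
        y' ∉ pathSites n g ∧ y' ∉ pathSites m k := by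
      refine fun y' ha hn1 hn2 => ⟨?_, ?_⟩
      · rintro ⟨j, hj, rfl⟩
        rw [← hg.head] at ha
        rcases Nat.eq_zero_or_pos j with rfl | hj0
        · exact ha.1 rfl
        · exact hn1 (by rw [hg.induced 0 j hj0 hj ha])
      · rintro ⟨j, hj, rfl⟩
        rw [← hk.head] at ha
        rcases Nat.eq_zero_or_pos j with rfl | hj0
        · exact ha.1 rfl
        · exact hn2 (by rw [hk.induced 0 j hj0 hj ha])
    have hin : ∀ y', adjStar x y' → y' ∈ Icc ((-M, -M) : Site) (M, M) := fun y' ha =>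
      h.inner hg (i := 0) hi (by rwa [hg.head])
    rw [hg.head] at hy
    rcases ring_center hsep.2 hy with ha | ⟨y', hy1, hy2, ha, ha'⟩
    · exact .single ⟨ha, .inr ⟨hin y hy, by simp [hyg, hyk]⟩⟩
    · have hst := adjStar_of_adjZ2 ha
      have := hon y' hst hy1 hy2
      exact .tail (.single ⟨ha, .inr ⟨hin y' hst, by simp [this]⟩⟩)
        ⟨ha', .inr ⟨hin y hy, by simp [hyg, hyk]⟩⟩
  | succ i ih =>
    have hu : adjStar (g (i + 1)) (g i) := adjStar_symm (hg.step i (by omega))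
    have hw : adjStar (g (i + 1)) (g (i + 2)) := hg.step (i + 1) (by omega)
    have hoff : ∀ y', adjStar (g (i + 1)) y' → y' ≠ g i → y' ≠ g (i + 2) →
        y' ∉ pathSites n g ∧ y' ∉ pathSites m k := by
      intro y' ha hn1 hn2
      rw [← not_or]
      intro hc
      rcases h.ring_eq_or hg hk (by omega) ha hc with h | h
      · exact hn1 h
      · exact hn2 h
    have hnot : ¬ adjStar (g i) (g (i + 2)) := fun hc => by
      have := hg.induced i (i + 2) (by omega) (by omega) hc
      omega
    refine ring_induction (T := fun y => Linked adjZ2 _ x y) hu hw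
      (hg.ne i (i + 2) (by omega) (by omega)) hnot ?_ ?_ y hy ?_ ?_
    · intro y' ha ha'
      have := hoff y' ha ha'.1.symm (fun hc => hnot (hc ▸ ha'))
      exact ih (by omega) ha' this.1 this.2
    · intro y' z hz hzu hzw ha hT
      have := hoff z hz hzu hzw
      exact .tail hT ⟨ha, .inr ⟨h.inner hg hi hz, by simp [this]⟩⟩
    · exact fun hc => hyg ⟨i, by omega, hc.symm⟩
    · exact fun hc => hyg ⟨i + 2, by omega, hc.symm⟩

/-- A crossing path can be opened up to a configuration without doubly-infinite self-repelling path
that acquires one when `x` is added. -/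
theorem IsCrossing.exists_config (h : IsCrossing M b x e P Q) :
    ∃ S : Config, Icc ((-M, -M) : Site) (M, M) \ (P ∪ Q) ⊆ S ∧ ¬ HasDISRPath adjZ2 S ∧
      HasDISRPath adjZ2 (insert x S) := by
  obtain ⟨n, g, hg⟩ := h.linked_P.exists_isInducedPath h.x_mem_P
  obtain ⟨m, k, hk⟩ := h.linked_Q.exists_isInducedPath h.x_mem_Q
  obtain ⟨hn, h1, h2⟩ := h.tip hg
  have hx := h.x_mem
  have hb := h.b_mem
  set B := Icc ((-M, -M) : Site) (M, M) \ (pathSites n g ∪ pathSites m k) with hB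
  have hBM : ∀ u ∈ B, u.1 ≤ M := fun u hu => hu.1.2.1
  set R : Set Site := {u | M < u.1 ∧ (u.2 = b + 1 ∨ u.2 = b - 1)} with hR
  refine ⟨B ∪ R, ?_, ?_, ?_⟩
  · rintro u ⟨hu, hPQ⟩
    refine .inl ⟨hu, ?_⟩
    rintro (⟨i, hi, rfl⟩ | ⟨i, hi, rfl⟩)
    · exact hPQ (.inl (hg.mem i hi))
    · exact hPQ (.inr (hk.mem i hi))
  · rintro ⟨γ, hinj, hmem, hadj⟩
    set s : Site → ZMod 2 := fun y => side M e n g m k (min y.1 M, y.2) with hs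
    have hsB : ∀ u ∈ B, s u = side M e n g m k u := fun u hu => by
      simp only [hs, min_eq_left (hBM u hu)]
    have hsR : ∀ u ∈ R, s u = side M e n g m k (M, u.2) := fun u hu => by
      simp only [hs, min_eq_right hu.1.le]
    have hBR : ∀ u v, u ∈ B → v ∈ R → adjZ2 u v → s u = s v := by
      intro u v hu hv ha
      rw [hsB u hu, hsR v hv]
      have a1 := hBM u hu
      have a2 := hv.1
      rw [adjZ2_iff] at ha
      congr 1
      rw [Prod.ext_iff]
      dsimp only
      omega
    have hconst : ∀ u v, u ∈ B ∪ R → v ∈ B ∪ R → adjZ2 u v → s u = s v := by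
      rintro u v (hu | hu) (hv | hv) ha
      · rw [hsB u hu, hsB v hv]
        exact side_eq_of_adj hg hk h.e_not_mem hu.1 hv.1 (fun hc => hu.2 (.inl hc))
          (fun hc => hu.2 (.inr hc)) (fun hc => hv.2 (.inl hc)) (fun hc => hv.2 (.inr hc)) ha
      · exact hBR u v hu hv ha
      · exact (hBR v u hv hu (adjZ2_symm ha)).symm
      · rw [hsR u hu, hsR v hv]
        have a1 := hu.2
        have a2 := hv.2
        rw [adjZ2_iff] at ha
        congr 1
        rw [Prod.ext_iff]
        dsimp only
        omega
    have hstep : ∀ i, adjZ2 (γ i) (γ (i + 1)) := fun i => (hadj i (i + 1)).2 (.inl rfl)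
    have hs0 : ∀ i, s (γ i) = s (γ 0) := by
      intro i
      induction i with
      | zero => rfl
      | succ i ih => rw [← ih, hconst _ _ (hmem _) (hmem _) (hstep i)]
      | pred i ih =>
        rw [← ih]
        have := hstep (-(i : ℤ) - 1)
        rw [sub_add_cancel] at this
        exact hconst _ _ (hmem _) (hmem _) this
    have hbox : ∀ i, (γ i).1 ≤ M → γ i ∈ Icc ((-M, -M) : Site) (M, M) := by
      intro i hi
      rcases hmem i with hm | hm
      · exact hm.1
      · exact absurd hm.1 (by omega)
    have hrow : ∀ i, M < (γ i).1 → ((γ i).2 = b + 1 ∨ (γ i).2 = b - 1) ∧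
        side M e n g m k (M, (γ i).2) = s (γ 0) := by
      intro i hi
      rcases hmem i with hm | hm
      · exact absurd (hBM _ hm) (by omega)
      · exact ⟨hm.2, by rw [← hs0 i, hsR _ hm]⟩
    have hne := h.side_ne hg hk
    by_cases hc : side M e n g m k (M, b + 1) = s (γ 0)
    · refine not_path_in_box_union_ray (t := b + 1) hinj hstep (fun i hi => ?_) hbox
      obtain ⟨h1 | h1, h2⟩ := hrow i hi
      · exact h1
      · rw [h1] at h2
        exact absurd (hc.trans h2.symm) hne
    · refine not_path_in_box_union_ray (t := b - 1) hinj hstep (fun i hi => ?_) hbox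
      obtain ⟨h1 | h1, h2⟩ := hrow i hi
      · rw [h1] at h2
        exact absurd h2 hc
      · exact h1
  · have hlink : ∀ c, c = b + 1 ∨ c = b - 1 → Linked adjZ2 (insert x B) x (M, c) := by
      intro c hc
      have hbs := h.beside hg hk hc
      refine h.linked_ring hg hk (i := n - 2) (by omega) ?_ hbs.1 hbs.2
      rw [h2, adjStar_iff]
      dsimp only
      omega
    have h3 := Linked.symm (fun _ _ => adjZ2_symm) (hlink _ (.inl rfl)) (mem_insert x B)
    have h4 : (M, b + 1) ∈ insert x B := by
      have hbs := h.beside hg hk (.inl rfl)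
      refine .inr ⟨?_, by simp [hbs]⟩
      simp only [mem_Icc, Prod.le_def]
      omega
    have h5 : Linked adjZ2 (insert x B) (M, b + 1) (M, b - 1) := .trans h3 (hlink _ (.inr rfl))
    obtain ⟨l, q, hq⟩ := h5.exists_isInducedPath h4
    refine hasDISRPath_of_rays hq ?_ (insert_subset_insert subset_union_left) ?_
    · rintro u (rfl | hu)
      · omega
      · exact hBM u hu
    · exact fun c hc => ⟨.inr (.inr ⟨hc, .inl rfl⟩), .inr (.inr ⟨hc, .inr rfl⟩)⟩

end Crossing

/-! ### Extending two arms of a disc to a crossing path -/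

/-- Squared Euclidean norm of a site. -/
def normSq (u : Site) : ℤ := u.1 ^ 2 + u.2 ^ 2

/-- `P` leads from `x` inside the disc `{normSq ≤ ρ}` to its only site `z` outside the disc. -/
structure IsArm (ρ : ℤ) (x : Site) (P : Set Site) (z : Site) : Prop where
  head_mem : x ∈ P
  tip_mem : z ∈ P
  mem : ∀ u ∈ P, normSq u ≤ ρ ∨ u = z
  lt_normSq : ρ < normSq z
  near : ∃ u, normSq u ≤ ρ ∧ adjStar u z
  linked : Linked adjStar P x z

/-- Two arms starting at `x` and separated away from `x`. -/
structure IsArmPair (ρ : ℤ) (x : Site) (P : Set Site) (z : Site) (Q : Set Site) (w : Site) :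
    Prop where
  normSq_le : normSq x ≤ ρ
  left : IsArm ρ x P z
  right : IsArm ρ x Q w
  sep : ∀ u ∈ P, ∀ w ∈ Q, u ≠ x → w ≠ x → u ≠ w ∧ ¬ adjStar u w

/-- The sites of the disc `{normSq ≤ ρ}` outside `P ∪ Q` can be extended to a configuration in which
`x` is pivotal for the existence of a doubly-infinite self-repelling path. -/
def HasPivotalConfig (ρ : ℤ) (x : Site) (P Q : Set Site) : Prop :=
  ∃ S : Config, {u | normSq u ≤ ρ} \ (P ∪ Q) ⊆ S ∧ ¬ HasDISRPath adjZ2 S ∧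
    HasDISRPath adjZ2 (insert x S)

theorem lt_of_step_outward {p q r s : ℤ} (h1 : q ≤ p) (h2 : -q ≤ p) (h3 : p + 1 ≤ r)
    (h4 : s - q ≤ 1) (h5 : q - s ≤ 1) : p ^ 2 + q ^ 2 < r ^ 2 + s ^ 2 := by
  have hr : (p + 1) ^ 2 ≤ r ^ 2 := by nlinarith
  have hs : q ^ 2 - 2 * p ≤ s ^ 2 := by
    obtain rfl | rfl | rfl : s = q ∨ s = q + 1 ∨ s = q - 1 := by omega
    · nlinarith
    · nlinarith
    · nlinarith
  nlinarith

theorem lt_normSq_ray {ρ p q t a b : ℤ} (h : ρ < p ^ 2 + q ^ 2) (ht : 0 ≤ t)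
    (hd : 0 ≤ p * a + q * b) : ρ < (p + t * a) ^ 2 + (q + t * b) ^ 2 := by
  nlinarith [mul_nonneg ht hd, sq_nonneg (t * a), sq_nonneg (t * b)]

set_option maxHeartbeats 400000 in
/-- The tip `w` of an arm can be extended along an axis away from the disc and from the ray going
right from the tip `z` of another arm, provided that `z` is at least as far out as `w`. -/
theorem exists_direction {ρ : ℤ} {z w : Site} (hz0 : 0 ≤ z.2) (hz : z.2 ≤ z.1)
    (hnear : ∃ u, normSq u ≤ ρ ∧ adjStar u z) (hρw : ρ < normSq w)
    (hzw : z ≠ w) (hadj : ¬ adjStar z w)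
    (hw : w.1 ≤ z.1 ∧ -w.1 ≤ z.1 ∧ w.2 ≤ z.1 ∧ -w.2 ≤ z.1) :
    ∃ v : Site, (v = (1, 0) ∨ v = (-1, 0) ∨ v = (0, 1) ∨ v = (0, -1)) ∧
      ∀ t : ℤ, 0 ≤ t → ρ < normSq (w.1 + t * v.1, w.2 + t * v.2) ∧
        (∀ u, normSq u ≤ ρ → adjStar u (w.1 + t * v.1, w.2 + t * v.2) → adjStar u w) ∧
        ∀ c, z.1 ≤ c → ((c, z.2) : Site) ≠ (w.1 + t * v.1, w.2 + t * v.2) ∧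
          ¬ adjStar (c, z.2) (w.1 + t * v.1, w.2 + t * v.2) := by
  obtain ⟨a, b⟩ := z
  obtain ⟨p, q⟩ := w
  obtain ⟨u₀, hu₀, ha₀⟩ := hnear
  rw [adjStar_iff] at hadj ha₀
  simp only [adjStar_iff, Ne, Prod.ext_iff, normSq] at *
  have hρ : 0 ≤ ρ := by linarith [sq_nonneg u₀.1, sq_nonneg u₀.2]
  have hw0 : ¬ (p = 0 ∧ q = 0) := by
    rintro ⟨rfl, rfl⟩
    simp at hρw
    omega
  have hne : ∀ u : Site, u.1 ^ 2 + u.2 ^ 2 ≤ ρ → ¬ (u.1 = p ∧ u.2 = q) := by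
    rintro u hu ⟨h1, h2⟩
    rw [h1, h2] at hu
    omega
  by_cases hup : p ≤ q ∧ -p ≤ q
  · refine ⟨(0, 1), by simp, fun t ht => ⟨?_, fun u hu ha => ?_, fun c hc => ?_⟩⟩
    · exact lt_normSq_ray hρw ht (by dsimp only; omega)
    · have h1 := hne u hu
      have h2 : u.2 ≤ q := by
        by_contra hc
        have := lt_of_step_outward hup.1 hup.2 (r := u.2) (s := u.1) (by omega) (by omega)
          (by omega)
        omega
      omega
    · dsimp only; omega
  by_cases hdown : p ≤ -q ∧ -p ≤ -q
  · refine ⟨(0, -1), by simp, fun t ht => ⟨?_, fun u hu ha => ?_, fun c hc => ?_⟩⟩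
    · exact lt_normSq_ray hρw ht (by dsimp only; omega)
    · have h1 := hne u hu
      have h2 : -u.2 ≤ -q := by
        by_contra hc
        have := lt_of_step_outward hdown.1 hdown.2 (r := -u.2) (s := u.1) (by omega) (by omega)
          (by omega)
        rw [neg_sq, neg_sq] at this
        omega
      omega
    · dsimp only; omega
  by_cases hleft : q ≤ -p ∧ -q ≤ -p
  · refine ⟨(-1, 0), by simp, fun t ht => ⟨?_, fun u hu ha => ?_, fun c hc => ?_⟩⟩
    · exact lt_normSq_ray hρw ht (by dsimp only; omega)
    · have h1 := hne u hu
      have h2 : -u.1 ≤ -p := by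
        by_contra hc
        have := lt_of_step_outward hleft.1 hleft.2 (r := -u.1) (s := u.2) (by omega) (by omega)
          (by omega)
        rw [neg_sq, neg_sq] at this
        omega
      omega
    · dsimp only; omega
  have hright : q < p ∧ -q < p := by omega
  by_cases hrow : b + 2 ≤ q ∨ q + 2 ≤ b
  · refine ⟨(1, 0), by simp, fun t ht => ⟨?_, fun u hu ha => ?_, fun c hc => ?_⟩⟩
    · exact lt_normSq_ray hρw ht (by dsimp only; omega)
    · have h1 := hne u hu
      have h2 : u.1 ≤ p := by
        by_contra hc
        have := lt_of_step_outward hright.1.le hright.2.le (r := u.1) (s := u.2) (by omega)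
          (by omega) (by omega)
        omega
      omega
    · dsimp only; omega
  have hpa : p ≤ a - 2 := by omega
  have hsq : (p + 1) ^ 2 ≤ (a - 1) ^ 2 := pow_le_pow_left₀ (by omega) (by omega) 2
  have hu1 : (a - 1) ^ 2 ≤ u₀.1 ^ 2 := pow_le_pow_left₀ (by omega) (by omega) 2
  have hb : b ≠ 0 := by
    rintro rfl
    have hq : q ^ 2 ≤ 1 ^ 2 := sq_le_sq.2 (by rw [abs_one, abs_le]; omega)
    have := sq_nonneg u₀.2
    linarith
  have hu2 : (b - 1) ^ 2 ≤ u₀.2 ^ 2 := pow_le_pow_left₀ (by omega) (by omega) 2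
  obtain rfl | rfl | rfl : q = b + 1 ∨ q = b ∨ q = b - 1 := by omega
  · have hpq : p < 2 * b := by linarith
    refine ⟨(0, 1), by simp, fun t ht => ⟨?_, fun u hu ha => ?_, fun c hc => ?_⟩⟩
    · exact lt_normSq_ray hρw ht (by dsimp only; omega)
    · have h1 := hne u hu
      have h2 : u.2 ≤ b + 2 := by
        by_contra hc
        have h3 : (p - 1) ^ 2 ≤ u.1 ^ 2 := pow_le_pow_left₀ (by omega) (by omega) 2
        have h4 : (b + 3) ^ 2 ≤ u.2 ^ 2 := pow_le_pow_left₀ (by omega) (by omega) 2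
        linarith
      omega
    · dsimp only; omega
  · linarith
  · linarith

theorem linked_ray {S : Set Site} {w v : Site} {n : ℕ}
    (hv : v = (1, 0) ∨ v = (-1, 0) ∨ v = (0, 1) ∨ v = (0, -1))
    (hS : ∀ t : ℤ, 0 ≤ t → t ≤ n → (w.1 + t * v.1, w.2 + t * v.2) ∈ S) :
    Linked adjStar S w (w.1 + n * v.1, w.2 + n * v.2) := by
  induction n with
  | zero =>
    simp only [Nat.cast_zero, zero_mul, add_zero]
    exact .refl
  | succ n ih =>
    refine .tail (ih fun t h0 h1 => hS t h0 (by push_cast; omega)) ⟨?_, hS _ (by omega) le_rfl⟩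
    rw [adjStar_iff]
    push_cast
    rcases hv with rfl | rfl | rfl | rfl <;> dsimp only <;> omega

theorem IsArmPair.hasPivotalConfig_of_oriented {ρ : ℤ} {x z w : Site} {P Q : Set Site}
    (h : IsArmPair ρ x P z Q w) (hz0 : 0 ≤ z.2) (hz : z.2 ≤ z.1)
    (hw : w.1 ≤ z.1 ∧ -w.1 ≤ z.1 ∧ w.2 ≤ z.1 ∧ -w.2 ≤ z.1) : HasPivotalConfig ρ x P Q := by
  have hne : ∀ u, ρ < normSq u → u ≠ x := by
    rintro u hu rfl
    exact absurd h.normSq_le (by omega)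
  have hzx := hne z h.left.lt_normSq
  have hwx := hne w h.right.lt_normSq
  have hzw := h.sep z h.left.tip_mem w h.right.tip_mem hzx hwx
  obtain ⟨v, hv, hray⟩ := exists_direction hz0 hz h.left.near h.right.lt_normSq hzw.1 hzw.2 hw
  have hray0 := hray 0 le_rfl
  simp only [zero_mul, add_zero] at hray0
  have hρ : 0 ≤ ρ := le_trans (by unfold normSq; positivity) h.normSq_le
  have hbd : ∀ u, normSq u ≤ ρ → -ρ ≤ u.1 ∧ u.1 ≤ ρ ∧ -ρ ≤ u.2 ∧ u.2 ≤ ρ := by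
    intro u hu
    unfold normSq at hu
    refine ⟨?_, ?_, ?_, ?_⟩ <;> nlinarith
  set M := ρ + z.1 + 4 with hM
  have hzray : ∀ c, z.1 ≤ c → ∀ u, normSq u ≤ ρ → u ≠ (c, z.2) ∧
      (adjStar (c, z.2) u → adjStar z u) := by
    intro c hc u hu
    have hlt := h.left.lt_normSq
    unfold normSq at hlt hu
    have hcu : u.1 ≤ z.1 ∨ 2 ≤ u.2 - z.2 ∨ 2 ≤ z.2 - u.2 := by
      by_contra hcon
      have := lt_of_step_outward hz (by omega) (r := u.1) (s := u.2) (by omega) (by omega)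
        (by omega)
      omega
    have hnz : ¬ (z.1 = u.1 ∧ z.2 = u.2) := by
      rintro ⟨h1, h2⟩
      rw [← h1, ← h2] at hu
      omega
    rw [adjStar_iff, adjStar_iff, Ne, Prod.ext_iff]
    dsimp only
    omega
  have hcross : IsCrossing M z.2 x (w.1 + (2 * M.toNat + 2 : ℕ) * v.1,
      w.2 + (2 * M.toNat + 2 : ℕ) * v.2) (P ∪ {u | z.1 ≤ u.1 ∧ u.1 ≤ M + 1 ∧ u.2 = z.2})
      (Q ∪ {u | ∃ t : ℤ, 0 ≤ t ∧ u = (w.1 + t * v.1, w.2 + t * v.2)}) := by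
    constructor
    · omega
    · have := hbd x h.normSq_le
      omega
    · rintro u (hu | hu)
      · rcases h.left.mem u hu with hu | rfl
        · have := hbd u hu
          omega
        · omega
      · have h1 := hu.1
        have h2 := hu.2
        omega
    · simp only [mem_Icc, Prod.le_def]
      push_cast
      rcases hv with rfl | rfl | rfl | rfl <;> dsimp only <;> omega
    · exact .inl h.left.head_mem
    · exact .inl h.right.head_mem
    · have h1 := linked_ray (S := P ∪ {u | z.1 ≤ u.1 ∧ u.1 ≤ M + 1 ∧ u.2 = z.2}) (w := z)
        (v := (1, 0)) (n := (M + 1 - z.1).toNat) (by simp)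
        (fun t h0 h1 => .inr ⟨by dsimp only; omega, by dsimp only; omega, by simp⟩)
      have h2 : Linked adjStar (P ∪ {u | z.1 ≤ u.1 ∧ u.1 ≤ M + 1 ∧ u.2 = z.2}) x _ :=
        Relation.ReflTransGen.trans (h.left.linked.mono subset_union_left) h1
      simp only [mul_one, mul_zero, add_zero] at h2
      rwa [show z.1 + ((M + 1 - z.1).toNat : ℤ) = M + 1 by omega] at h2
    · exact Relation.ReflTransGen.trans (h.right.linked.mono subset_union_left)
        (linked_ray hv fun t h0 _ => .inr ⟨t, h0, rfl⟩)
    · rintro u (hu | ⟨hu1, -, hu2⟩) w' (hw' | ⟨t, ht, rfl⟩) hux hwx'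
      · exact h.sep u hu w' hw' hux hwx'
      · rcases h.left.mem u hu with hu' | rfl
        · refine ⟨?_, fun ha => ?_⟩
          · rintro rfl
            exact absurd (hray t ht).1 (by omega)
          · exact (h.sep u hu w h.right.tip_mem hux hwx).2 ((hray t ht).2.1 u hu' ha)
        · exact (hray t ht).2.2 _ le_rfl
      · have hu : u = (u.1, z.2) := Prod.ext rfl hu2
        rw [hu]
        rcases h.right.mem w' hw' with hw1 | rfl
        · have := hzray u.1 hu1 w' hw1
          exact ⟨this.1.symm,
            fun ha => (h.sep z h.left.tip_mem w' hw' hzx hwx').2 (this.2 ha)⟩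
        · exact hray0.2.2 _ hu1
      · have hu : u = (u.1, z.2) := Prod.ext rfl hu2
        rw [hu]
        exact (hray t ht).2.2 _ hu1
  obtain ⟨S, hS, hno, hyes⟩ := hcross.exists_config
  refine ⟨S, ?_, hno, hyes⟩
  rintro u ⟨hu, hPQ⟩
  change normSq u ≤ ρ at hu
  refine hS ⟨?_, ?_⟩
  · have := hbd u hu
    simp only [mem_Icc, Prod.le_def]
    omega
  · rintro ((hP | ⟨h1, -, h2⟩) | (hQ | ⟨t, ht, rfl⟩))
    · exact hPQ (.inl hP)
    · exact (hzray u.1 h1 u hu).1 (Prod.ext rfl h2)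
    · exact hPQ (.inr hQ)
    · exact absurd (hray t ht).1 (by omega)

/-- Involutive symmetries of the lattice fixing the origin. -/
structure IsSymmetry (f : Site → Site) : Prop where
  invol : ∀ u, f (f u) = u
  adjStar_iff : ∀ u v, adjStar (f u) (f v) ↔ adjStar u v
  adjZ2_iff : ∀ u v, adjZ2 (f u) (f v) ↔ adjZ2 u v
  normSq_eq : ∀ u, normSq (f u) = normSq u

theorem IsSymmetry.isArm {f : Site → Site} (hf : IsSymmetry f) {ρ : ℤ} {x z : Site} {P : Set Site}
    (h : IsArm ρ x P z) : IsArm ρ (f x) (f ⁻¹' P) (f z) where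
  head_mem := by simpa [hf.invol] using h.head_mem
  tip_mem := by simpa [hf.invol] using h.tip_mem
  mem u hu := by
    rcases h.mem _ hu with h1 | h1
    · exact .inl (by rwa [hf.normSq_eq] at h1)
    · exact .inr (by rw [← h1, hf.invol])
  lt_normSq := by rw [hf.normSq_eq]; exact h.lt_normSq
  near := by
    obtain ⟨u, h1, h2⟩ := h.near
    exact ⟨f u, by rwa [hf.normSq_eq], (hf.adjStar_iff _ _).2 h2⟩
  linked := Relation.ReflTransGen.lift f
    (fun u v huv => ⟨(hf.adjStar_iff _ _).2 huv.1, by simpa [hf.invol] using huv.2⟩) _ _ h.linked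

theorem IsSymmetry.isArmPair {f : Site → Site} (hf : IsSymmetry f) {ρ : ℤ} {x z w : Site}
    {P Q : Set Site} (h : IsArmPair ρ x P z Q w) :
    IsArmPair ρ (f x) (f ⁻¹' P) (f z) (f ⁻¹' Q) (f w) where
  normSq_le := by rw [hf.normSq_eq]; exact h.normSq_le
  left := hf.isArm h.left
  right := hf.isArm h.right
  sep u hu w hw hux hwx := by
    have hne : ∀ v, v ≠ f x → f v ≠ x := fun v hv he => hv (by rw [← he, hf.invol])
    have := h.sep _ hu _ hw (hne u hux) (hne w hwx)
    rw [hf.adjStar_iff] at this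
    exact ⟨fun he => this.1 (by rw [he]), this.2⟩

theorem IsSymmetry.hasDISRPath {f : Site → Site} (hf : IsSymmetry f) {S : Config}
    (h : HasDISRPath adjZ2 (f ⁻¹' S)) : HasDISRPath adjZ2 S := by
  obtain ⟨γ, hinj, hmem, hadj⟩ := h
  have hfi : Function.Injective f := Function.LeftInverse.injective hf.invol
  exact ⟨f ∘ γ, hfi.comp hinj, hmem, fun i j => (hf.adjZ2_iff _ _).trans (hadj i j)⟩

theorem IsSymmetry.hasPivotalConfig {f : Site → Site} (hf : IsSymmetry f) {ρ : ℤ} {x : Site}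
    {P Q : Set Site} (h : HasPivotalConfig ρ (f x) (f ⁻¹' P) (f ⁻¹' Q)) :
    HasPivotalConfig ρ x P Q := by
  obtain ⟨S, hS, hno, hyes⟩ := h
  refine ⟨f ⁻¹' S, ?_, fun hc => hno (hf.hasDISRPath hc), ?_⟩
  · rintro u ⟨hu, hPQ⟩
    refine hS ⟨?_, ?_⟩
    · change normSq (f u) ≤ ρ
      rw [hf.normSq_eq]
      exact hu
    · simpa [hf.invol] using hPQ
  · refine hf.hasDISRPath ?_
    convert hyes using 1
    ext u
    simp only [mem_preimage, mem_insert_iff, hf.invol]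
    refine or_congr ⟨fun he => by rw [← he, hf.invol], fun he => by rw [he, hf.invol]⟩ Iff.rfl

theorem isSymmetry_neg_fst : IsSymmetry fun u => (-u.1, u.2) where
  invol u := by simp
  adjStar_iff u v := by rw [PercEnh.adjStar_iff, PercEnh.adjStar_iff]; dsimp only; omega
  adjZ2_iff u v := by rw [PercEnh.adjZ2_iff, PercEnh.adjZ2_iff]; dsimp only; omega
  normSq_eq u := by simp [normSq]

theorem isSymmetry_swap : IsSymmetry fun u => (u.2, u.1) where
  invol u := by simp
  adjStar_iff u v := by rw [PercEnh.adjStar_iff, PercEnh.adjStar_iff]; dsimp only; omega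
  adjZ2_iff u v := by rw [PercEnh.adjZ2_iff, PercEnh.adjZ2_iff]; dsimp only; omega
  normSq_eq u := by simp [normSq, add_comm]

theorem isSymmetry_neg_snd : IsSymmetry fun u => (u.1, -u.2) where
  invol u := by simp
  adjStar_iff u v := by rw [PercEnh.adjStar_iff, PercEnh.adjStar_iff]; dsimp only; omega
  adjZ2_iff u v := by rw [PercEnh.adjZ2_iff, PercEnh.adjZ2_iff]; dsimp only; omega
  normSq_eq u := by simp [normSq]

theorem IsArmPair.symm {ρ : ℤ} {x z w : Site} {P Q : Set Site} (h : IsArmPair ρ x P z Q w) :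
    IsArmPair ρ x Q w P z where
  normSq_le := h.normSq_le
  left := h.right
  right := h.left
  sep u hu v hv hux hvx := by
    have := h.sep v hv u hu hvx hux
    exact ⟨this.1.symm, fun ha => this.2 (adjStar_symm ha)⟩

theorem IsArmPair.hasPivotalConfig {ρ : ℤ} {x z w : Site} {P Q : Set Site}
    (h : IsArmPair ρ x P z Q w) : HasPivotalConfig ρ x P Q := by
  have h1 : ∀ {x z w : Site} {P Q : Set Site}, IsArmPair ρ x P z Q w → 0 ≤ z.1 → 0 ≤ z.2 →
      max |w.1| |w.2| ≤ max |z.1| |z.2| → HasPivotalConfig ρ x P Q := by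
    intro x z w P Q h hz1 hz2 hw
    rw [abs_of_nonneg hz1, abs_of_nonneg hz2] at hw
    have hw1 := abs_le.1 ((le_max_left _ _).trans hw)
    have hw2 := abs_le.1 ((le_max_right _ _).trans hw)
    rcases le_total z.2 z.1 with hz | hz
    · exact h.hasPivotalConfig_of_oriented hz2 hz (by omega)
    · exact isSymmetry_swap.hasPivotalConfig
        ((isSymmetry_swap.isArmPair h).hasPivotalConfig_of_oriented hz1 hz (by dsimp only; omega))
  have h2 : ∀ {x z w : Site} {P Q : Set Site}, IsArmPair ρ x P z Q w → 0 ≤ z.1 →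
      max |w.1| |w.2| ≤ max |z.1| |z.2| → HasPivotalConfig ρ x P Q := by
    intro x z w P Q h hz1 hw
    rcases le_total 0 z.2 with hz | hz
    · exact h1 h hz1 hz hw
    · exact isSymmetry_neg_snd.hasPivotalConfig
        (h1 (isSymmetry_neg_snd.isArmPair h) hz1 (by simpa using hz) (by simpa using hw))
  have h3 : ∀ {x z w : Site} {P Q : Set Site}, IsArmPair ρ x P z Q w →
      max |w.1| |w.2| ≤ max |z.1| |z.2| → HasPivotalConfig ρ x P Q := by
    intro x z w P Q h hw
    rcases le_total 0 z.1 with hz | hz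
    · exact h2 h hz hw
    · exact isSymmetry_neg_fst.hasPivotalConfig
        (h2 (isSymmetry_neg_fst.isArmPair h) (by simpa using hz) (by simpa using hw))
  rcases le_total (max |w.1| |w.2|) (max |z.1| |z.2|) with hw | hw
  · exact h3 h hw
  · obtain ⟨S, hS, hr⟩ := h3 h.symm hw
    exact ⟨S, union_comm P Q ▸ hS, hr⟩

/-! ### Truncating closed paths to arms -/

theorem siteNorm_eq (u : Site) : siteNorm u = ‖(⟨u.1, u.2⟩ : ℂ)‖ := by
  rw [siteNorm, Complex.norm_def, Complex.normSq_mk, sq, sq]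

theorem siteNorm_add_le (u v : Site) : siteNorm (u + v) ≤ siteNorm u + siteNorm v := by
  simp only [siteNorm_eq]
  refine le_trans (le_of_eq ?_) (norm_add_le _ _)
  congr 1
  apply Complex.ext <;> simp

theorem siteNorm_neg (u : Site) : siteNorm (-u) = siteNorm u := by simp [siteNorm]

theorem mem_siteBall_iff {R : ℝ} (hR : 0 ≤ R) {u : Site} :
    u ∈ siteBall R ↔ normSq u ≤ ⌊R ^ 2⌋ := by
  rw [siteBall, mem_ofPred_eq, siteNorm, Real.sqrt_le_left hR, Int.le_floor, normSq]
  push_cast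
  rfl

theorem notMem_siteBall_of_far {R : ℝ} {v x u : Site} (hu : u ∈ siteBall R)
    (hv : 2 * R < siteNorm (v - x)) : v - (x - u) ∉ siteBall R := by
  intro h
  have h1 := siteNorm_add_le (v - (x - u)) (-u)
  rw [siteNorm_neg, show v - (x - u) + -u = v - x by abel] at h1
  have h2 : siteNorm u ≤ R := hu
  have h3 : siteNorm (v - (x - u)) ≤ R := h
  linarith

theorem adjStar_add_right (u v y : Site) : adjStar (u + y) (v + y) ↔ adjStar u v := by
  simp only [adjStar_iff, Prod.fst_add, Prod.snd_add]
  omega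

theorem exists_isArm {ρ : ℤ} {x : Site} {l : List Site} (hl : l.IsChain adjStar)
    (hhead : l.head? = some x) (hx : normSq x ≤ ρ) (hout : ∃ v ∈ l, ρ < normSq v) :
    ∃ z P, IsArm ρ x P z ∧ ∀ u ∈ P, u ∈ l := by
  induction l generalizing x with
  | nil => simp at hhead
  | cons a l ih =>
    obtain rfl : a = x := by simpa using hhead
    obtain ⟨v, hv, hvo⟩ := hout
    have hvl : v ∈ l := by
      rcases List.mem_cons.1 hv with rfl | h
      · omega
      · exact h
    obtain ⟨b, l, rfl⟩ := List.exists_cons_of_ne_nil (List.ne_nil_of_mem hvl)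
    rw [List.isChain_cons_cons] at hl
    by_cases hb : normSq b ≤ ρ
    · obtain ⟨z, P, h, hP⟩ := ih hl.2 rfl hb ⟨v, hvl, hvo⟩
      refine ⟨z, insert a P, ⟨.inl rfl, .inr h.tip_mem, ?_, h.lt_normSq, h.near, ?_⟩, ?_⟩
      · rintro u (rfl | hu)
        · exact .inl hx
        · exact h.mem u hu
      · exact .head ⟨hl.1, .inr h.head_mem⟩ (h.linked.mono (subset_insert a P))
      · rintro u (rfl | hu)
        · simp
        · exact List.mem_cons_of_mem _ (hP u hu)
    · push Not at hb
      refine ⟨b, {a, b}, ⟨by simp, by simp, ?_, hb, ⟨a, hx, hl.1⟩, ?_⟩, ?_⟩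
      · rintro u (rfl | rfl)
        · exact .inl hx
        · exact .inr rfl
      · exact .single ⟨hl.1, by simp⟩
      · rintro u (rfl | rfl) <;> simp

theorem exists_isArm_of_closedStarPath {R : ℝ} {ω : Config} {x y : Site} {l : List Site}
    (hR : 0 ≤ R) (hl : ClosedStarPath ω l) (hhead : l.head? = some (x + y))
    (hx : x ∈ siteBall R) (hout : ∃ v ∈ l, 2 * R < siteNorm (v - (x + y))) :
    ∃ z P, IsArm ⌊R ^ 2⌋ x P z ∧ ∀ u ∈ P, u + y ∈ l := by
  obtain ⟨v, hv, hvo⟩ := hout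
  obtain ⟨z, P, h, hP⟩ := exists_isArm (ρ := ⌊R ^ 2⌋) (x := x) (l := l.map (· - y))
    ((List.isChain_map _).2 (hl.2.2.1.imp fun a b hab => by
      rwa [← adjStar_add_right _ _ y, sub_add_cancel, sub_add_cancel]))
    (by simp [hhead]) ((mem_siteBall_iff hR).1 hx)
    ⟨v - y, List.mem_map_of_mem hv, by
      have := notMem_siteBall_of_far hx hvo
      rwa [add_sub_cancel_left, mem_siteBall_iff hR, not_le] at this⟩
  refine ⟨z, P, h, fun u hu => ?_⟩
  obtain ⟨a, ha, rfl⟩ := List.mem_map.1 (hP u hu)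
  rwa [sub_add_cancel]

theorem HasDISRPath.mono {adj : Site → Site → Prop} {S T : Config} (h : HasDISRPath adj S)
    (hST : S ⊆ T) : HasDISRPath adj T := by
  obtain ⟨γ, hinj, hmem, hadj⟩ := h
  exact ⟨γ, hinj, fun i => hST (hmem i), hadj⟩

/-- stability lemma: let `φ` be a monotonic nonessential
enhancement of range `R₀`, `R = 2R₀`, and `ω` a configuration in which `x` is closed.
If there are two closed `*`-paths starting at `x`, each containing a site outside
`B_x(R)`, and which apart from `x` are disjoint and mutually non-`*`-adjacent, then
`x` remains closed in the fully enhanced configuration `ω̃`. -/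
theorem stable_site_stays_closed
    (R₀ : ℝ) (φ : Config → Config) (hφ : IsEnhancement R₀ φ)
    (hmono : Monotonic φ) (hness : ¬ Essential adjZ2 φ)
    (ω : Config) (x : Site) (hx : x ∉ ω)
    (l₁ l₂ : List Site)
    (h₁ : ClosedStarPath ω l₁) (h₂ : ClosedStarPath ω l₂)
    (hh₁ : l₁.head? = some x) (hh₂ : l₂.head? = some x)
    (hout₁ : ∃ z ∈ l₁, 2 * R₀ < siteNorm (z - x))
    (hout₂ : ∃ z ∈ l₂, 2 * R₀ < siteNorm (z - x))
    (hsep : ∀ z ∈ l₁, ∀ w ∈ l₂, z ≠ x → w ≠ x → z ≠ w ∧ ¬ adjStar z w) :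
    x ∉ fullyEnhanced φ ω := by
  rintro (hmem | ⟨y, x, hmem, rfl⟩)
  · exact hx hmem
  dsimp only at *
  obtain ⟨hR, hball, hloc⟩ := hφ
  have hxR := hball _ hmem
  obtain ⟨z, P, hP, hPl⟩ := exists_isArm_of_closedStarPath hR h₁ hh₁ hxR hout₁
  obtain ⟨w, Q, hQ, hQl⟩ := exists_isArm_of_closedStarPath hR h₂ hh₂ hxR hout₂
  have hpair : IsArmPair ⌊R₀ ^ 2⌋ x P z Q w :=
    { normSq_le := (mem_siteBall_iff hR).1 hxR
      left := hP
      right := hQ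
      sep := fun u hu v hv hux hvx => by
        have := hsep _ (hPl u hu) _ (hQl v hv) (by simpa using hux) (by simpa using hvx)
        rwa [adjStar_add_right, Ne, add_left_inj] at this }
  obtain ⟨S, hS, hno, hyes⟩ := hpair.hasPivotalConfig
  refine hness ⟨S, hno, hyes.mono (insert_subset (.inr ?_) subset_union_left)⟩
  rw [hloc _ (shiftConfig y ω ∩ siteBall R₀) (by rw [inter_assoc, inter_self])] at hmem
  refine hmono _ _ ?_ hmem
  rintro u ⟨hu, huR⟩
  refine hS ⟨(mem_siteBall_iff hR).1 huR, ?_⟩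
  rintro (huP | huQ)
  · exact h₁.2.2.2 _ (hPl u huP) hu
  · exact h₂.2.2.2 _ (hQl u huQ) hu

end PercEnh
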